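/- Let Z : ℝ⁴ → (Fin 4 → ℝ) be a smooth vector field with vanishing divergence, ∂_a Z^a = 0 everywhere (index raised with η). Then there exists a smooth field X : ℝ⁴ → (Fin 4 → Fin 4 → ℝ) of antisymmetric matrices which is closed, ∂_a X_{bc} + ∂_b X_{ca} + ∂_c X_{ab} = 0 everywhere, and whose divergence is Z: ∂_b X^{ab} = Z^a everywhere. -/

import Mathlib

noncomputable section

/-- The Minkowski metric diag(-1,1,1,1); it equals its own inverse. -/
def mink : Fin 4 → Fin 4 → ℝ :=
  fun a b => if a = b then (if a = 0 then -1 else 1) else 0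

/-- The Levi-Civita symbol, totally antisymmetric with `lev 0 1 2 3 = 1`. -/
def lev (a b c d : Fin 4) : ℝ :=
  (((b : ℕ) : ℝ) - ((a : ℕ) : ℝ)) * (((c : ℕ) : ℝ) - ((a : ℕ) : ℝ)) *
      (((d : ℕ) : ℝ) - ((a : ℕ) : ℝ)) * (((c : ℕ) : ℝ) - ((b : ℕ) : ℝ)) *
      (((d : ℕ) : ℝ) - ((b : ℕ) : ℝ)) * (((d : ℕ) : ℝ) - ((c : ℕ) : ℝ)) / 12

/-- Raise one index with the metric: `A^a = η^{ab} A_b`. -/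
def raise1 (A : Fin 4 → ℝ) : Fin 4 → ℝ :=
  fun a => ∑ b, mink a b * A b

/-- Raise both indices of a second rank tensor: `X^{ab} = η^{ac} η^{bd} X_{cd}`. -/
def raise2 (X : Fin 4 → Fin 4 → ℝ) : Fin 4 → Fin 4 → ℝ :=
  fun a b => ∑ c, ∑ d, mink a c * mink b d * X c d

/-- The Hodge dual of a second rank tensor: `(*X)_{ab} = (1/2) ε_{abcd} X^{cd}`. -/
def hodge (X : Fin 4 → Fin 4 → ℝ) : Fin 4 → Fin 4 → ℝ :=
  fun a b => (1 / 2) * ∑ c, ∑ d, lev a b c d * raise2 X c d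

/-- The partial derivative of a function on ℝ⁴ in the `a`-th coordinate direction. -/
def pd (a : Fin 4) (f : (Fin 4 → ℝ) → ℝ) (x : Fin 4 → ℝ) : ℝ :=
  fderiv ℝ f x (Pi.single a 1)

/-- The α-current of a field of antisymmetric matrices: `Z^a = ∂_b X^{ab}`. -/
def alphaCurrent (X : (Fin 4 → ℝ) → Fin 4 → Fin 4 → ℝ) (a : Fin 4) (x : Fin 4 → ℝ) : ℝ :=
  ∑ b, pd b (fun y => raise2 (X y) a b) x

/-- The β-current of a field of antisymmetric matrices: `Y^a = ∂_b (*X)^{ab}`. -/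
def betaCurrent (X : (Fin 4 → ℝ) → Fin 4 → Fin 4 → ℝ) (a : Fin 4) (x : Fin 4 → ℝ) : ℝ :=
  ∑ b, pd b (fun y => raise2 (hodge (X y)) a b) x


section ParamIntegral

open MeasureTheory

/-- Derivative of a parametric interval integral with a smooth integrand. -/
theorem hasFDerivAt_param {E G : Type} [NormedAddCommGroup E] [NormedSpace ℝ E] [ProperSpace E]
    [NormedAddCommGroup G] [NormedSpace ℝ G] (f : E × ℝ → G)
    (hf : ContDiff ℝ 1 f) (a b : ℝ) (x : E) :
    HasFDerivAt (fun y => ∫ s in a..b, f (y, s))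
      (∫ s in a..b, (fderiv ℝ f (x, s)).comp (ContinuousLinearMap.inl ℝ E ℝ)) x := by
  have hc : Continuous (fun p : E × ℝ =>
      (fderiv ℝ f p).comp (ContinuousLinearMap.inl ℝ E ℝ)) :=
    (hf.continuous_fderiv one_ne_zero).clm_comp continuous_const
  obtain ⟨C, hC⟩ := ((isCompact_closedBall x (1 : ℝ)).prod
    (isCompact_uIcc (a := a) (b := b))).exists_bound_of_continuousOn hc.continuousOn
  refine intervalIntegral.hasFDerivAt_integral_of_dominated_of_fderiv_le
    (F := fun y s => f (y, s))
    (F' := fun y s => (fderiv ℝ f (y, s)).comp (ContinuousLinearMap.inl ℝ E ℝ))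
    (bound := fun _ => C) (s := Metric.closedBall x 1)
    (Metric.closedBall_mem_nhds x one_pos) ?_ ?_ ?_ ?_ ?_ ?_
  · exact Filter.Eventually.of_forall fun y =>
      (hf.continuous.comp (by fun_prop : Continuous fun s : ℝ => (y, s))).aestronglyMeasurable
  · exact (hf.continuous.comp (by fun_prop : Continuous fun s : ℝ => (x, s))).intervalIntegrable _ _
  · exact (hc.comp (by fun_prop : Continuous fun s : ℝ => (x, s))).aestronglyMeasurable
  · refine Filter.Eventually.of_forall fun t ht y hy => ?_
    exact hC (y, t) ⟨hy, Set.uIoc_subset_uIcc ht⟩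
  · exact intervalIntegrable_const
  · refine Filter.Eventually.of_forall fun t ht y hy => ?_
    have h1 : HasFDerivAt f (fderiv ℝ f (y, t)) (y, t) :=
      (hf.differentiable one_ne_zero _).hasFDerivAt
    exact h1.comp y (hasFDerivAt_prodMk_left y t)

theorem contDiff_param_nat {E : Type} [NormedAddCommGroup E] [NormedSpace ℝ E] [ProperSpace E]
    (a b : ℝ) (n : ℕ) : ∀ {G : Type} [NormedAddCommGroup G] [NormedSpace ℝ G] (f : E × ℝ → G),
    ContDiff ℝ (⊤ : ℕ∞) f → ContDiff ℝ n (fun y => ∫ s in a..b, f (y, s)) := by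
  induction n with
  | zero =>
    intro G _ _ f hf
    have h : Differentiable ℝ (fun y => ∫ s in a..b, f (y, s)) := fun x =>
      (hasFDerivAt_param f (hf.of_le (by simp)) a b x).differentiableAt
    exact contDiff_zero.2 h.continuous
  | succ n ih =>
    intro G _ _ f hf
    have := (contDiff_succ_iff_hasFDerivAt (𝕜 := ℝ) (n := n)
      (f := fun y => ∫ s in a..b, f (y, s))).2
      ⟨fun x => ∫ s in a..b, (fderiv ℝ f (x, s)).comp (ContinuousLinearMap.inl ℝ E ℝ),
        ih (fun p : E × ℝ => (fderiv ℝ f p).comp (ContinuousLinearMap.inl ℝ E ℝ))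
        ((hf.fderiv_right (m := (⊤ : ℕ∞)) (by simp)).clm_comp contDiff_const),
        fun x => hasFDerivAt_param f (hf.of_le (by simp)) a b x⟩
    exact_mod_cast this

theorem contDiff_param {E G : Type} [NormedAddCommGroup E] [NormedSpace ℝ E] [ProperSpace E]
    [NormedAddCommGroup G] [NormedSpace ℝ G] (a b : ℝ) (f : E × ℝ → G)
    (hf : ContDiff ℝ (⊤ : ℕ∞) f) : ContDiff ℝ (⊤ : ℕ∞) (fun y => ∫ s in a..b, f (y, s)) :=
  contDiff_infty.2 fun n => contDiff_param_nat a b n f hf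

theorem fderiv_param {E : Type} [NormedAddCommGroup E] [NormedSpace ℝ E] [ProperSpace E]
    (a b : ℝ) (f : E × ℝ → ℝ) (hf : ContDiff ℝ (⊤ : ℕ∞) f) (x v : E) :
    fderiv ℝ (fun y => ∫ s in a..b, f (y, s)) x v = ∫ s in a..b, fderiv ℝ f (x, s) (v, 0) := by
  rw [(hasFDerivAt_param f (hf.of_le (by simp)) a b x).fderiv]
  rw [ContinuousLinearMap.intervalIntegral_apply]
  · simp
  · have hc : Continuous (fun p : E × ℝ =>
      (fderiv ℝ f p).comp (ContinuousLinearMap.inl ℝ E ℝ)) :=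
      (hf.continuous_fderiv (by simp)).clm_comp continuous_const
    exact (hc.comp (by fun_prop : Continuous fun s : ℝ => (x, s))).intervalIntegrable _ _

theorem contDiff_dir {E : Type} [NormedAddCommGroup E] [NormedSpace ℝ E]
    {f : E → ℝ} (hf : ContDiff ℝ (⊤ : ℕ∞) f) (v : E) :
    ContDiff ℝ (⊤ : ℕ∞) (fun x => fderiv ℝ f x v) :=
  (hf.fderiv_right (m := (⊤ : ℕ∞)) (by simp)).clm_apply contDiff_const

/-- Directional derivatives computed along a line. -/
theorem fderiv_line {E : Type} [NormedAddCommGroup E] [NormedSpace ℝ E]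
    {f : E → ℝ} (hf : ContDiff ℝ (⊤ : ℕ∞) f) (x v : E) (d : ℝ)
    (h : HasDerivAt (fun t : ℝ => f (x + t • v)) d 0) : fderiv ℝ f x v = d := by
  have h1 : HasFDerivAt f (fderiv ℝ f x) (x + (0 : ℝ) • v) := by
    simpa using (hf.differentiable (by simp) x).hasFDerivAt
  have h2 : HasDerivAt (fun t : ℝ => x + t • v) v 0 := by
    simpa using ((hasDerivAt_id (0 : ℝ)).smul_const v).const_add x
  exact (h1.comp_hasDerivAt 0 h2).unique h

/-- Smoothness of an integral with a variable upper limit. -/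
theorem contDiff_var {E : Type} [NormedAddCommGroup E] [NormedSpace ℝ E] [ProperSpace E]
    (K : E × ℝ → ℝ) (hK : ContDiff ℝ (⊤ : ℕ∞) K) :
    ContDiff ℝ (⊤ : ℕ∞) (fun p : E × ℝ => ∫ s in (0 : ℝ)..p.2, K (p.1, s)) := by
  have h1 : (fun p : E × ℝ => ∫ s in (0 : ℝ)..p.2, K (p.1, s))
      = fun p : E × ℝ => p.2 * ∫ s in (0 : ℝ)..1, K (p.1, p.2 * s) := by
    funext p
    have := intervalIntegral.mul_integral_comp_mul_left (a := 0) (b := 1)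
      (f := fun s => K (p.1, s)) p.2
    simpa using this.symm
  rw [h1]
  refine contDiff_snd.mul (contDiff_param 0 1 (fun q : (E × ℝ) × ℝ => K (q.1.1, q.1.2 * q.2)) ?_)
  exact hK.comp (by fun_prop)

theorem fderiv_var {E : Type} [NormedAddCommGroup E] [NormedSpace ℝ E] [ProperSpace E]
    (K : E × ℝ → ℝ) (hK : ContDiff ℝ (⊤ : ℕ∞) K) (x v : E) (t w : ℝ) :
    fderiv ℝ (fun p : E × ℝ => ∫ s in (0 : ℝ)..p.2, K (p.1, s)) (x, t) (v, w)
      = w * K (x, t) + ∫ s in (0 : ℝ)..t, fderiv ℝ K (x, s) (v, 0) := by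
  have hs := contDiff_var K hK
  have hd : HasFDerivAt (fun p : E × ℝ => ∫ s in (0 : ℝ)..p.2, K (p.1, s)) _ (x, t) :=
    (hs.differentiable (by simp) (x, t)).hasFDerivAt
  have e1 := (HasFDerivAt.comp (f := fun e : E => (e, t)) x hd (hasFDerivAt_prodMk_left x t)).fderiv
  have e2 := (HasFDerivAt.comp (f := fun e : ℝ => (x, e)) t hd (hasFDerivAt_prodMk_right x t)).fderiv
  have f1 := fderiv_param 0 t K hK x v
  have hcont : Continuous fun s : ℝ => K (x, s) :=
    hK.continuous.comp (by fun_prop)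
  have f2 := (hcont.deriv_integral (fun s => K (x, s)) 0 t)
  have g1 : fderiv ℝ (fun p : E × ℝ => ∫ s in (0 : ℝ)..p.2, K (p.1, s)) (x, t) (v, 0)
      = ∫ s in (0 : ℝ)..t, fderiv ℝ K (x, s) (v, 0) := by
    rw [← f1]
    have := congrArg (fun L => L v) e1
    simpa [Function.comp_def] using this.symm
  have g2 : fderiv ℝ (fun p : E × ℝ => ∫ s in (0 : ℝ)..p.2, K (p.1, s)) (x, t) (0, 1)
      = K (x, t) := by
    rw [← f2]
    have := congrArg (fun L => L 1) e2
    simpa [Function.comp_def] using this.symm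
  have : ((v, w) : E × ℝ) = (v, 0) + w • (0, 1) := by simp
  rw [this, map_add, map_smul, g1, g2, smul_eq_mul, add_comm]

end ParamIntegral

section PdBasics

theorem contDiff_pd {f : (Fin 4 → ℝ) → ℝ} (hf : ContDiff ℝ (⊤ : ℕ∞) f) (a : Fin 4) :
    ContDiff ℝ (⊤ : ℕ∞) (pd a f) := contDiff_dir hf _

theorem pd_comm {f : (Fin 4 → ℝ) → ℝ} (hf : ContDiff ℝ (⊤ : ℕ∞) f) (a b : Fin 4)
    (x : Fin 4 → ℝ) : pd a (pd b f) x = pd b (pd a f) x := by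
  have hs : IsSymmSndFDerivAt ℝ f x := (hf.of_le (m := 2) (WithTop.coe_le_coe.2 (le_top : (2 : ℕ∞) ≤ ⊤))).contDiffAt.isSymmSndFDerivAt (by simp)
  have hd : DifferentiableAt ℝ (fderiv ℝ f) x :=
    (hf.fderiv_right (m := (⊤ : ℕ∞)) (by simp)).differentiable (by simp) x
  have key : ∀ u v : Fin 4 → ℝ, fderiv ℝ (fun y => fderiv ℝ f y v) x u
      = fderiv ℝ (fderiv ℝ f) x u v := by
    intro u v
    rw [fderiv_clm_apply hd (by fun_prop)]
    simp
  unfold pd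
  rw [key, key]
  exact hs _ _

theorem pd_add {f g : (Fin 4 → ℝ) → ℝ} (hf : ContDiff ℝ (⊤ : ℕ∞) f)
    (hg : ContDiff ℝ (⊤ : ℕ∞) g) (a : Fin 4) (x : Fin 4 → ℝ) :
    pd a (fun y => f y + g y) x = pd a f x + pd a g x := by
  unfold pd
  rw [fderiv_fun_add (hf.differentiable (by simp) x) (hg.differentiable (by simp) x)]
  rfl

theorem pd_sub {f g : (Fin 4 → ℝ) → ℝ} (hf : ContDiff ℝ (⊤ : ℕ∞) f)
    (hg : ContDiff ℝ (⊤ : ℕ∞) g) (a : Fin 4) (x : Fin 4 → ℝ) :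
    pd a (fun y => f y - g y) x = pd a f x - pd a g x := by
  unfold pd
  rw [fderiv_fun_sub (hf.differentiable (by simp) x) (hg.differentiable (by simp) x)]
  rfl

theorem pd_cmul {f : (Fin 4 → ℝ) → ℝ} (hf : ContDiff ℝ (⊤ : ℕ∞) f) (c : ℝ)
    (a : Fin 4) (x : Fin 4 → ℝ) :
    pd a (fun y => c * f y) x = c * pd a f x := by
  unfold pd
  rw [fderiv_const_mul (hf.differentiable (by simp) x)]
  rfl

theorem pd_sum {f : Fin 4 → (Fin 4 → ℝ) → ℝ} (hf : ∀ i, ContDiff ℝ (⊤ : ℕ∞) (f i))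
    (a : Fin 4) (x : Fin 4 → ℝ) :
    pd a (fun y => ∑ i, f i y) x = ∑ i, pd a (f i) x := by
  unfold pd
  rw [fderiv_fun_sum (fun i _ => (hf i).differentiable (by simp) x)]
  simp

theorem hasDerivAt_of_eq {f g : ℝ → ℝ} {d e t : ℝ} (h : HasDerivAt g e t)
    (hf : ∀ s, f s = g s) (he : d = e) : HasDerivAt f d t := by
  rw [funext hf, he]; exact h

/-- Chain rule along a curve in terms of partial derivatives. -/
theorem hasDerivAt_curve {f : (Fin 4 → ℝ) → ℝ} (hf : ContDiff ℝ (⊤ : ℕ∞) f)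
    {γ : ℝ → Fin 4 → ℝ} {γ' : Fin 4 → ℝ} {t : ℝ}
    (h : ∀ i, HasDerivAt (fun s => γ s i) (γ' i) t) :
    HasDerivAt (fun s => f (γ s)) (∑ i, γ' i * pd i f (γ t)) t := by
  have h1 : HasFDerivAt f (fderiv ℝ f (γ t)) (γ t) :=
    (hf.differentiable (by simp) _).hasFDerivAt
  have h2 := h1.comp_hasDerivAt t (hasDerivAt_pi.2 h)
  have key : fderiv ℝ f (γ t) γ' = ∑ i, γ' i * pd i f (γ t) := by
    have e : γ' = ∑ i, γ' i • (Pi.single i 1 : Fin 4 → ℝ) := by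
      funext j; simp [Finset.sum_apply, Pi.single_apply]
    conv_lhs => rw [e]
    rw [map_sum]
    exact Finset.sum_congr rfl fun i _ => by rw [map_smul]; rfl
  rw [← key]
  exact h2

end PdBasics

section Poincare

/-- Poincare lemma: a divergence-free field is the divergence of an antisymmetric one. -/
theorem exists_potential (Z : Fin 4 → (Fin 4 → ℝ) → ℝ)
    (hZ : ∀ a, ContDiff ℝ (⊤ : ℕ∞) (Z a))
    (hdiv : ∀ x : Fin 4 → ℝ, (∑ a, pd a (Z a) x) = 0) :
    ∃ W : Fin 4 → Fin 4 → (Fin 4 → ℝ) → ℝ,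
      (∀ a b, ContDiff ℝ (⊤ : ℕ∞) (W a b)) ∧ (∀ a b x, W a b x = - W b a x) ∧
      (∀ a x, ∑ b, pd b (W a b) x = Z a x) := by
  let g : Fin 4 → Fin 4 → (Fin 4 → ℝ) × ℝ → ℝ := fun a b q =>
    q.2 ^ 2 * (Z a (q.2 • q.1) * q.1 b - Z b (q.2 • q.1) * q.1 a)
  have hsm : ContDiff ℝ (⊤ : ℕ∞) (fun q : (Fin 4 → ℝ) × ℝ => q.2 • q.1) :=
    contDiff_snd.smul contDiff_fst
  have hco : ∀ b : Fin 4, ContDiff ℝ (⊤ : ℕ∞) (fun q : (Fin 4 → ℝ) × ℝ => q.1 b) :=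
    fun b => (contDiff_apply ℝ ℝ b).comp contDiff_fst
  have hg : ∀ a b, ContDiff ℝ (⊤ : ℕ∞) (g a b) := fun a b =>
    (contDiff_snd.pow 2).mul ((((hZ a).comp hsm).mul (hco b)).sub (((hZ b).comp hsm).mul (hco a)))
  have hline : ∀ (x : Fin 4 → ℝ) (b i : Fin 4),
      HasDerivAt (fun t : ℝ => x i + t * (Pi.single b (1 : ℝ) : Fin 4 → ℝ) i)
        ((Pi.single b (1 : ℝ) : Fin 4 → ℝ) i) 0 := fun x b i => by
    simpa using ((hasDerivAt_id (0 : ℝ)).mul_const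
      ((Pi.single b (1 : ℝ) : Fin 4 → ℝ) i)).const_add (x i)
  have hZl : ∀ (c b : Fin 4) (x : Fin 4 → ℝ) (s : ℝ),
      HasDerivAt (fun t : ℝ => Z c (s • (x + t • (Pi.single b (1 : ℝ) : Fin 4 → ℝ))))
        (s * pd b (Z c) (s • x)) 0 := by
    intro c b x s
    have := hasDerivAt_curve (hZ c) (t := 0)
      (γ := fun t : ℝ => s • (x + t • (Pi.single b (1 : ℝ) : Fin 4 → ℝ)))
      (γ' := fun i => s * (Pi.single b (1 : ℝ) : Fin 4 → ℝ) i)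
      (fun i => by simpa using (hline x b i).const_mul s)
    simpa [Pi.single_apply] using this
  have hdg : ∀ (a b : Fin 4) (x : Fin 4 → ℝ) (s : ℝ),
      fderiv ℝ (g a b) (x, s) (Pi.single b 1, 0) =
        s ^ 2 * ((s * pd b (Z a) (s • x) * x b + Z a (s • x))
          - (s * pd b (Z b) (s • x) * x a
            + Z b (s • x) * (Pi.single b (1 : ℝ) : Fin 4 → ℝ) a)) := by
    intro a b x s
    apply fderiv_line (hg a b)
    have := (((hZl a b x s).mul (hline x b b)).sub
      ((hZl b b x s).mul (hline x b a))).const_mul (s ^ 2)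
    refine hasDerivAt_of_eq this (fun t => ?_) ?_
    · simp [g]
    · simp
  refine ⟨fun a b x => ∫ s in (0 : ℝ)..1, g a b (x, s), fun a b => contDiff_param 0 1 _ (hg a b),
    ?_, ?_⟩
  · intro a b x
    change (∫ s in (0 : ℝ)..1, g a b (x, s)) = - ∫ s in (0 : ℝ)..1, g b a (x, s)
    rw [← intervalIntegral.integral_neg]
    congr 1
    funext s
    simp only [g]; ring
  · intro a x
    have h1 : ∀ b, pd b (fun x => ∫ s in (0 : ℝ)..1, g a b (x, s)) x
        = ∫ s in (0 : ℝ)..1, fderiv ℝ (g a b) (x, s) (Pi.single b 1, 0) :=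
      fun b => fderiv_param 0 1 (g a b) (hg a b) x _
    simp only [h1]
    rw [← intervalIntegral.integral_finsetSum]
    · have hd : ∀ s : ℝ, HasDerivAt (fun s : ℝ => s ^ 3 * Z a (s • x))
          (∑ b, fderiv ℝ (g a b) (x, s) (Pi.single b 1, 0)) s := by
        intro s
        have hc := hasDerivAt_curve (hZ a) (t := s) (γ := fun s : ℝ => s • x) (γ' := x)
          (fun i => by simpa using (hasDerivAt_id s).mul_const (x i))
        have := (hasDerivAt_pow 3 s).mul hc
        refine hasDerivAt_of_eq this (fun t => rfl) ?_
        simp only [hdg]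
        have h0 := hdiv (s • x)
        have hs : ∑ b, Z b (s • x) * (Pi.single b (1 : ℝ) : Fin 4 → ℝ) a = Z a (s • x) := by
          simp [Pi.single_apply]
        simp only [Fin.sum_univ_four] at h0 hs ⊢
        push_cast
        linear_combination (- s ^ 3 * x a) * h0 - s ^ 2 * hs
      rw [intervalIntegral.integral_eq_sub_of_hasDerivAt (fun s _ => hd s)]
      · simp
      · refine Continuous.intervalIntegrable ?_ _ _
        refine continuous_finsetSum _ fun b _ => ?_
        exact (contDiff_dir (hg a b) _).continuous.comp (by fun_prop : Continuous fun s : ℝ => (x, s))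
    · intro b _
      refine Continuous.intervalIntegrable ?_ _ _
      exact (contDiff_dir (hg a b) _).continuous.comp (by fun_prop : Continuous fun s : ℝ => (x, s))

end Poincare

section Sphere

open Real

/-- Integration over the two angles. -/
def angInt (h : ((((Fin 4 → ℝ) × ℝ) × ℝ) × ℝ) → ℝ) (p : (Fin 4 → ℝ) × ℝ) : ℝ :=
  ∫ θ in (0 : ℝ)..π, ∫ φ in (0 : ℝ)..(2 * π), h ((p, θ), φ)

theorem contDiff_angInt {h : ((((Fin 4 → ℝ) × ℝ) × ℝ) × ℝ) → ℝ}
    (hh : ContDiff ℝ (⊤ : ℕ∞) h) : ContDiff ℝ (⊤ : ℕ∞) (angInt h) :=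
  contDiff_param 0 π (fun q : (((Fin 4 → ℝ) × ℝ) × ℝ) => ∫ φ in (0 : ℝ)..(2 * π), h (q, φ))
    (contDiff_param 0 (2 * π) h hh)

theorem fderiv_angInt {h : ((((Fin 4 → ℝ) × ℝ) × ℝ) × ℝ) → ℝ}
    (hh : ContDiff ℝ (⊤ : ℕ∞) h) (p v : (Fin 4 → ℝ) × ℝ) :
    fderiv ℝ (angInt h) p v = angInt (fun q => fderiv ℝ h q ((v, 0), 0)) p := by
  have h1 := fderiv_param 0 π
    (fun q : (((Fin 4 → ℝ) × ℝ) × ℝ) => ∫ φ in (0 : ℝ)..(2 * π), h (q, φ))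
    (contDiff_param 0 (2 * π) h hh) p v
  have h2 := fun q w => fderiv_param 0 (2 * π) h hh q w
  simp only [h2] at h1
  exact h1

theorem angInt_add {h k : ((((Fin 4 → ℝ) × ℝ) × ℝ) × ℝ) → ℝ}
    (hh : ContDiff ℝ (⊤ : ℕ∞) h) (hk : ContDiff ℝ (⊤ : ℕ∞) k) (p : (Fin 4 → ℝ) × ℝ) :
    angInt (fun q => h q + k q) p = angInt h p + angInt k p := by
  unfold angInt
  rw [← intervalIntegral.integral_add]
  · congr 1
    funext θ
    rw [intervalIntegral.integral_add]
    · exact (hh.continuous.comp (by fun_prop)).intervalIntegrable _ _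
    · exact (hk.continuous.comp (by fun_prop)).intervalIntegrable _ _
  · exact ((contDiff_param 0 (2 * π) h hh).continuous.comp
      (by fun_prop : Continuous fun θ : ℝ => (p, θ))).intervalIntegrable _ _
  · exact ((contDiff_param 0 (2 * π) k hk).continuous.comp
      (by fun_prop : Continuous fun θ : ℝ => (p, θ))).intervalIntegrable _ _

/-- The spatial unit vector with spherical coordinates `θ, φ`. -/
def nvec (θ φ : ℝ) : Fin 4 → ℝ := ![0, sin θ * cos φ, sin θ * sin φ, cos θ]

/-- Its derivative in `θ`. -/
def tvec (θ φ : ℝ) : Fin 4 → ℝ := ![0, cos θ * cos φ, cos θ * sin φ, - sin θ]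

/-- The unit vector in the direction of increasing `φ`. -/
def pvec (φ : ℝ) : Fin 4 → ℝ := ![0, - sin φ, cos φ, 0]

/-- Minus the derivative of `pvec`. -/
def rvec (φ : ℝ) : Fin 4 → ℝ := ![0, cos φ, sin φ, 0]

theorem nvec_deriv_theta (θ φ : ℝ) (i : Fin 4) :
    HasDerivAt (fun t => nvec t φ i) (tvec θ φ i) θ := by
  fin_cases i
  · simpa [nvec, tvec] using hasDerivAt_const θ (0 : ℝ)
  · simpa [nvec, tvec] using (hasDerivAt_sin θ).mul_const (cos φ)
  · simpa [nvec, tvec] using (hasDerivAt_sin θ).mul_const (sin φ)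
  · simpa [nvec, tvec] using (hasDerivAt_cos θ)

theorem nvec_deriv_phi (θ φ : ℝ) (i : Fin 4) :
    HasDerivAt (fun t => nvec θ t i) (sin θ * pvec φ i) φ := by
  fin_cases i
  · simpa [nvec, pvec] using hasDerivAt_const φ (0 : ℝ)
  · simpa [nvec, pvec] using (hasDerivAt_cos φ).const_mul (sin θ)
  · simpa [nvec, pvec] using (hasDerivAt_sin φ).const_mul (sin θ)
  · simpa [nvec, pvec] using (hasDerivAt_const φ (cos θ))

theorem tvec_deriv_theta (θ φ : ℝ) (i : Fin 4) :
    HasDerivAt (fun t => tvec t φ i) (- nvec θ φ i) θ := by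
  fin_cases i
  · simpa [nvec, tvec] using hasDerivAt_const θ (0 : ℝ)
  · simpa [nvec, tvec] using (hasDerivAt_cos θ).mul_const (cos φ)
  · simpa [nvec, tvec] using (hasDerivAt_cos θ).mul_const (sin φ)
  · simpa [nvec, tvec] using (hasDerivAt_sin θ).fun_neg

theorem pvec_deriv_phi (φ : ℝ) (i : Fin 4) :
    HasDerivAt (fun t => pvec t i) (- rvec φ i) φ := by
  fin_cases i
  · simpa [rvec, pvec] using hasDerivAt_const φ (0 : ℝ)
  · simpa [rvec, pvec] using (hasDerivAt_sin φ).fun_neg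
  · simpa [rvec, pvec] using (hasDerivAt_cos φ)
  · simpa [rvec, pvec] using (hasDerivAt_const φ (0 : ℝ))

theorem contDiff_nvec (i : Fin 4) :
    ContDiff ℝ (⊤ : ℕ∞) (fun q : ℝ × ℝ => nvec q.1 q.2 i) := by
  fin_cases i
  · exact contDiff_const
  · exact (by fun_prop : ContDiff ℝ (⊤ : ℕ∞) (fun q : ℝ × ℝ => sin q.1 * cos q.2))
  · exact (by fun_prop : ContDiff ℝ (⊤ : ℕ∞) (fun q : ℝ × ℝ => sin q.1 * sin q.2))
  · exact (by fun_prop : ContDiff ℝ (⊤ : ℕ∞) (fun q : ℝ × ℝ => cos q.1))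

theorem contDiff_tvec (i : Fin 4) :
    ContDiff ℝ (⊤ : ℕ∞) (fun q : ℝ × ℝ => tvec q.1 q.2 i) := by
  fin_cases i
  · exact contDiff_const
  · exact (by fun_prop : ContDiff ℝ (⊤ : ℕ∞) (fun q : ℝ × ℝ => cos q.1 * cos q.2))
  · exact (by fun_prop : ContDiff ℝ (⊤ : ℕ∞) (fun q : ℝ × ℝ => cos q.1 * sin q.2))
  · exact (by fun_prop : ContDiff ℝ (⊤ : ℕ∞) (fun q : ℝ × ℝ => - sin q.1))

theorem contDiff_pvec (i : Fin 4) :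
    ContDiff ℝ (⊤ : ℕ∞) (fun q : ℝ => pvec q i) := by
  fin_cases i
  · exact contDiff_const
  · exact (by fun_prop : ContDiff ℝ (⊤ : ℕ∞) (fun q : ℝ => - sin q))
  · exact (by fun_prop : ContDiff ℝ (⊤ : ℕ∞) (fun q : ℝ => cos q))
  · exact contDiff_const

/-- The integrand of the spherical mean. -/
def sphF (f : (Fin 4 → ℝ) → ℝ) (q : (((Fin 4 → ℝ) × ℝ) × ℝ) × ℝ) : ℝ :=
  q.1.1.2 * sin q.1.2 * f (q.1.1.1 + q.1.1.2 • nvec q.1.2 q.2)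

theorem contDiff_pt : ContDiff ℝ (⊤ : ℕ∞) (fun q : (((Fin 4 → ℝ) × ℝ) × ℝ) × ℝ =>
    q.1.1.1 + q.1.1.2 • nvec q.1.2 q.2) := by
  have h1 : ∀ i, ContDiff ℝ (⊤ : ℕ∞)
      (fun q : (((Fin 4 → ℝ) × ℝ) × ℝ) × ℝ => nvec q.1.2 q.2 i) := by
    intro i
    fin_cases i
    · exact contDiff_const
    · exact (by fun_prop : ContDiff ℝ (⊤ : ℕ∞)
        (fun q : (((Fin 4 → ℝ) × ℝ) × ℝ) × ℝ => sin q.1.2 * cos q.2))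
    · exact (by fun_prop : ContDiff ℝ (⊤ : ℕ∞)
        (fun q : (((Fin 4 → ℝ) × ℝ) × ℝ) × ℝ => sin q.1.2 * sin q.2))
    · exact (by fun_prop : ContDiff ℝ (⊤ : ℕ∞)
        (fun q : (((Fin 4 → ℝ) × ℝ) × ℝ) × ℝ => cos q.1.2))
  have h2 : ContDiff ℝ (⊤ : ℕ∞) (fun q : (((Fin 4 → ℝ) × ℝ) × ℝ) × ℝ => q.1.1.1) := by
    fun_prop
  have h3 : ContDiff ℝ (⊤ : ℕ∞) (fun q : (((Fin 4 → ℝ) × ℝ) × ℝ) × ℝ => q.1.1.2) := by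
    fun_prop
  refine contDiff_pi.2 fun i => ?_
  exact (contDiff_pi.1 h2 i).add (h3.mul (h1 i))

theorem contDiff_sphF {f : (Fin 4 → ℝ) → ℝ} (hf : ContDiff ℝ (⊤ : ℕ∞) f) :
    ContDiff ℝ (⊤ : ℕ∞) (sphF f) :=
  (by fun_prop : ContDiff ℝ (⊤ : ℕ∞) fun q : (((Fin 4 → ℝ) × ℝ) × ℝ) × ℝ =>
    q.1.1.2 * sin q.1.2).mul (hf.comp contDiff_pt)

/-- First radial derivative of the integrand. -/
def sphF1 (f : (Fin 4 → ℝ) → ℝ) (q : (((Fin 4 → ℝ) × ℝ) × ℝ) × ℝ) : ℝ :=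
  sin q.1.2 * f (q.1.1.1 + q.1.1.2 • nvec q.1.2 q.2)
    + q.1.1.2 * sin q.1.2 * ∑ i, nvec q.1.2 q.2 i * pd i f (q.1.1.1 + q.1.1.2 • nvec q.1.2 q.2)

/-- Second radial derivative of the integrand. -/
def sphF2 (f : (Fin 4 → ℝ) → ℝ) (q : (((Fin 4 → ℝ) × ℝ) × ℝ) × ℝ) : ℝ :=
  2 * sin q.1.2 * (∑ i, nvec q.1.2 q.2 i * pd i f (q.1.1.1 + q.1.1.2 • nvec q.1.2 q.2))
    + q.1.1.2 * sin q.1.2 * ∑ i, nvec q.1.2 q.2 i * ∑ j, nvec q.1.2 q.2 j *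
      pd j (pd i f) (q.1.1.1 + q.1.1.2 • nvec q.1.2 q.2)

theorem sph_line_r {f : (Fin 4 → ℝ) → ℝ} (hf : ContDiff ℝ (⊤ : ℕ∞) f)
    (x n : Fin 4 → ℝ) (r : ℝ) :
    HasDerivAt (fun t : ℝ => f (x + (r + t) • n)) (∑ i, n i * pd i f (x + r • n)) 0 := by
  have := hasDerivAt_curve hf (t := 0) (γ := fun t : ℝ => x + (r + t) • n) (γ' := n)
    (fun i => by
      simpa using (((hasDerivAt_id (0 : ℝ)).const_add r).mul_const (n i)).const_add (x i))
  simpa using this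

theorem fderiv_sphF_r {f : (Fin 4 → ℝ) → ℝ} (hf : ContDiff ℝ (⊤ : ℕ∞) f)
    (q : (((Fin 4 → ℝ) × ℝ) × ℝ) × ℝ) :
    fderiv ℝ (sphF f) q (((0, 1), 0), 0) = sphF1 f q := by
  obtain ⟨⟨⟨x, r⟩, θ⟩, φ⟩ := q
  apply fderiv_line (contDiff_sphF hf)
  have h1 : HasDerivAt (fun t : ℝ => (r + t) * sin θ) (sin θ) 0 := by
    simpa using ((hasDerivAt_id (0 : ℝ)).const_add r).mul_const (sin θ)
  have := h1.mul (sph_line_r hf x (nvec θ φ) r)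
  refine hasDerivAt_of_eq this (fun t => ?_) ?_
  · simp [sphF]
  · simp [sphF1]

theorem contDiff_sphF1 {f : (Fin 4 → ℝ) → ℝ} (hf : ContDiff ℝ (⊤ : ℕ∞) f) :
    ContDiff ℝ (⊤ : ℕ∞) (sphF1 f) := by
  have : sphF1 f = fun q => fderiv ℝ (sphF f) q (((0, 1), 0), 0) :=
    funext fun q => (fderiv_sphF_r hf q).symm
  rw [this]
  exact contDiff_dir (contDiff_sphF hf) _

theorem fderiv_sphF1_r {f : (Fin 4 → ℝ) → ℝ} (hf : ContDiff ℝ (⊤ : ℕ∞) f)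
    (q : (((Fin 4 → ℝ) × ℝ) × ℝ) × ℝ) :
    fderiv ℝ (sphF1 f) q (((0, 1), 0), 0) = sphF2 f q := by
  obtain ⟨⟨⟨x, r⟩, θ⟩, φ⟩ := q
  apply fderiv_line (contDiff_sphF1 hf)
  have h1 : HasDerivAt (fun t : ℝ => (r + t) * sin θ) (sin θ) 0 := by
    simpa using ((hasDerivAt_id (0 : ℝ)).const_add r).mul_const (sin θ)
  have h2 : HasDerivAt (fun t : ℝ => ∑ i, nvec θ φ i * pd i f (x + (r + t) • nvec θ φ))
      (∑ i, nvec θ φ i * ∑ j, nvec θ φ j * pd j (pd i f) (x + r • nvec θ φ)) 0 :=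
    HasDerivAt.fun_sum fun i _ =>
      (sph_line_r (contDiff_pd hf i) x (nvec θ φ) r).const_mul (nvec θ φ i)
  have := ((sph_line_r hf x (nvec θ φ) r).const_mul (sin θ)).add (h1.mul h2)
  refine hasDerivAt_of_eq this (fun t => ?_) ?_
  · simp [sphF1]
  · simp only [sphF2, add_zero]; ring

theorem contDiff_sphF2 {f : (Fin 4 → ℝ) → ℝ} (hf : ContDiff ℝ (⊤ : ℕ∞) f) :
    ContDiff ℝ (⊤ : ℕ∞) (sphF2 f) := by
  have : sphF2 f = fun q => fderiv ℝ (sphF1 f) q (((0, 1), 0), 0) :=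
    funext fun q => (fderiv_sphF1_r hf q).symm
  rw [this]
  exact contDiff_dir (contDiff_sphF1 hf) _

theorem fderiv_sphF_x {f : (Fin 4 → ℝ) → ℝ} (hf : ContDiff ℝ (⊤ : ℕ∞) f) (i : Fin 4)
    (q : (((Fin 4 → ℝ) × ℝ) × ℝ) × ℝ) :
    fderiv ℝ (sphF f) q (((Pi.single i 1, 0), 0), 0) = sphF (pd i f) q := by
  obtain ⟨⟨⟨x, r⟩, θ⟩, φ⟩ := q
  apply fderiv_line (contDiff_sphF hf)
  have h1 := hasDerivAt_curve hf (t := 0)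
    (γ := fun t : ℝ => x + t • (Pi.single i (1 : ℝ) : Fin 4 → ℝ) + r • nvec θ φ)
    (γ' := Pi.single i (1 : ℝ))
    (fun j => by
      simpa using (((hasDerivAt_id (0 : ℝ)).mul_const
        ((Pi.single i (1 : ℝ) : Fin 4 → ℝ) j)).const_add (x j)).add_const (r * nvec θ φ j))
  have := h1.const_mul (r * sin θ)
  refine hasDerivAt_of_eq this (fun t => ?_) ?_
  · simp [sphF]
  · simp [sphF, Pi.single_apply]

end Sphere

section Darboux

open Real

/-- The angular remainder integrates to zero. -/
theorem angular_zero {f : (Fin 4 → ℝ) → ℝ} (hf : ContDiff ℝ (⊤ : ℕ∞) f)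
    (x : Fin 4 → ℝ) (r : ℝ) :
    angInt (fun q => sphF (fun y => pd 1 (pd 1 f) y + (pd 2 (pd 2 f) y + pd 3 (pd 3 f) y)) q
      - sphF2 f q) (x, r) = 0 := by
  let N : ℝ × ℝ → Fin 4 → ℝ := fun q => x + r • nvec q.1 q.2
  have hN : ContDiff ℝ (⊤ : ℕ∞) N := by
    have h1 : ContDiff ℝ (⊤ : ℕ∞) (fun q : ℝ × ℝ => nvec q.1 q.2) :=
      contDiff_pi.2 fun i => contDiff_nvec i
    exact contDiff_const.add (h1.const_smul r)
  let P : ℝ × ℝ → ℝ := fun q => ∑ i, pvec q.2 i * pd i f (N q)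
  let Q : ℝ × ℝ → ℝ := fun q => sin q.1 * ∑ i, tvec q.1 q.2 i * pd i f (N q)
  have hP : ContDiff ℝ (⊤ : ℕ∞) P := ContDiff.sum fun i _ =>
    (ContDiff.comp (g := fun s : ℝ => pvec s i) (contDiff_pvec i) contDiff_snd).mul
      (ContDiff.comp (g := pd i f) (contDiff_pd hf i) hN)
  have hQ : ContDiff ℝ (⊤ : ℕ∞) Q :=
    (by fun_prop : ContDiff ℝ (⊤ : ℕ∞) fun q : ℝ × ℝ => sin q.1).mul (ContDiff.sum fun i _ =>
      (contDiff_tvec i).mul (ContDiff.comp (g := pd i f) (contDiff_pd hf i) hN))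
  have dP : ∀ θ φ : ℝ, HasDerivAt (fun t => P (θ, t))
      (∑ i, (- rvec φ i * pd i f (N (θ, φ))
        + pvec φ i * ∑ j, r * (sin θ * pvec φ j) * pd j (pd i f) (N (θ, φ)))) φ := by
    intro θ φ
    refine HasDerivAt.fun_sum fun i _ => ?_
    refine (pvec_deriv_phi φ i).mul ?_
    refine hasDerivAt_curve (contDiff_pd hf i) (γ := fun t => N (θ, t)) fun j => ?_
    exact ((nvec_deriv_phi θ φ j).const_mul r).const_add (x j)
  have dQ : ∀ θ φ : ℝ, HasDerivAt (fun t => Q (t, φ))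
      (cos θ * (∑ i, tvec θ φ i * pd i f (N (θ, φ))) +
        sin θ * ∑ i, (- nvec θ φ i * pd i f (N (θ, φ))
        + tvec θ φ i * ∑ j, r * tvec θ φ j * pd j (pd i f) (N (θ, φ)))) θ := by
    intro θ φ
    refine (hasDerivAt_sin θ).mul ?_
    refine HasDerivAt.fun_sum fun i _ => ?_
    refine (tvec_deriv_theta θ φ i).mul ?_
    refine hasDerivAt_curve (contDiff_pd hf i) (γ := fun t => N (t, φ)) fun j => ?_
    exact ((nvec_deriv_theta θ φ j).const_mul r).const_add (x j)
  have shift : ∀ {g : ℝ → ℝ} {d a : ℝ}, HasDerivAt g d a →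
      HasDerivAt (fun t => g (a + t)) d 0 := by
    intro g d a h
    exact HasDerivAt.comp_const_add a 0 (by simpa using h)
  have fP : ∀ θ φ : ℝ, HasDerivAt (fun t => P (θ, t)) (fderiv ℝ P (θ, φ) (0, 1)) φ := by
    intro θ φ
    have := fderiv_line hP (θ, φ) (0, 1) _
      (hasDerivAt_of_eq (shift (dP θ φ)) (fun t => by simp) rfl)
    rw [this]; exact dP θ φ
  have fQ : ∀ θ φ : ℝ, HasDerivAt (fun t => Q (t, φ)) (fderiv ℝ Q (θ, φ) (1, 0)) θ := by
    intro θ φ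
    have := fderiv_line hQ (θ, φ) (1, 0) _
      (hasDerivAt_of_eq (shift (dQ θ φ)) (fun t => by simp) rfl)
    rw [this]; exact dQ θ φ
  have key : ∀ θ φ : ℝ,
      sphF (fun y => pd 1 (pd 1 f) y + (pd 2 (pd 2 f) y + pd 3 (pd 3 f) y)) (((x, r), θ), φ)
      - sphF2 f (((x, r), θ), φ)
      = fderiv ℝ Q (θ, φ) (1, 0) + fderiv ℝ P (θ, φ) (0, 1) := by
    intro θ φ
    rw [(fQ θ φ).unique (dQ θ φ), (fP θ φ).unique (dP θ φ)]
    have hN' : x + r • nvec θ φ = N (θ, φ) := rfl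
    simp only [sphF, sphF2, hN']
    have c12 := pd_comm hf 2 1 (N (θ, φ))
    have c13 := pd_comm hf 3 1 (N (θ, φ))
    have c23 := pd_comm hf 3 2 (N (θ, φ))
    have hθ := sin_sq_add_cos_sq θ
    have hφ := sin_sq_add_cos_sq φ
    simp only [Fin.sum_univ_four, c12, c13, c23]
    generalize pd 1 (pd 1 f) (N (θ, φ)) = f11
    generalize pd 2 (pd 2 f) (N (θ, φ)) = f22
    generalize pd 3 (pd 3 f) (N (θ, φ)) = f33
    generalize pd 1 (pd 2 f) (N (θ, φ)) = f12
    generalize pd 1 (pd 3 f) (N (θ, φ)) = f13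
    generalize pd 2 (pd 3 f) (N (θ, φ)) = f23
    generalize pd 1 f (N (θ, φ)) = f1
    generalize pd 2 f (N (θ, φ)) = f2
    generalize pd 3 f (N (θ, φ)) = f3
    simp only [nvec, tvec, pvec, rvec, Matrix.cons_val]
    linear_combination (r * sin θ * f11) * (- cos φ ^ 2 * hθ - hφ)
      + (r * sin θ * f22) * (- sin φ ^ 2 * hθ - hφ) - r * sin θ * f33 * hθ
      - 2 * r * sin θ * cos φ * sin φ * f12 * hθ - cos φ * f1 * hθ - sin φ * f2 * hθ
  unfold angInt
  simp only [key]
  have iQ : ∀ θ : ℝ, (∫ φ in (0 : ℝ)..(2 * π),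
      (fderiv ℝ Q (θ, φ) (1, 0) + fderiv ℝ P (θ, φ) (0, 1)))
      = ∫ φ in (0 : ℝ)..(2 * π), fderiv ℝ Q (θ, φ) (1, 0) := by
    intro θ
    have c1 : Continuous fun φ : ℝ => fderiv ℝ Q (θ, φ) (1, 0) :=
      (contDiff_dir hQ _).continuous.comp (by fun_prop : Continuous fun φ : ℝ => (θ, φ))
    have c2 : Continuous fun φ : ℝ => fderiv ℝ P (θ, φ) (0, 1) :=
      (contDiff_dir hP _).continuous.comp (by fun_prop : Continuous fun φ : ℝ => (θ, φ))
    rw [intervalIntegral.integral_add (c1.intervalIntegrable _ _) (c2.intervalIntegrable _ _),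
      intervalIntegral.integral_eq_sub_of_hasDerivAt (fun φ _ => fP θ φ)
        (c2.intervalIntegrable _ _)]
    have : P (θ, 2 * π) = P (θ, 0) := by simp [P, N, pvec, nvec]
    rw [this]; ring
  simp only [iQ]
  let R : ℝ → ℝ := fun θ => ∫ φ in (0 : ℝ)..(2 * π), Q (θ, φ)
  have hR : ContDiff ℝ (⊤ : ℕ∞) R := contDiff_param 0 (2 * π) Q hQ
  have dR : ∀ θ, HasDerivAt R (∫ φ in (0 : ℝ)..(2 * π), fderiv ℝ Q (θ, φ) (1, 0)) θ := by
    intro θ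
    have h1 := (hR.differentiable (by simp) θ).hasDerivAt
    have h2 := fderiv_param 0 (2 * π) Q hQ θ 1
    rw [← h2]; exact h1
  rw [intervalIntegral.integral_eq_sub_of_hasDerivAt (fun θ _ => dR θ)]
  · simp [R, Q]
  · exact ((contDiff_param 0 (2 * π) (fun q => fderiv ℝ Q q (1, 0))
      (contDiff_dir hQ _)).continuous).intervalIntegrable _ _

/-- The spherical mean (times radius and `4π`). -/
def sph (f : (Fin 4 → ℝ) → ℝ) : (Fin 4 → ℝ) × ℝ → ℝ := angInt (sphF f)

theorem contDiff_sph {f : (Fin 4 → ℝ) → ℝ} (hf : ContDiff ℝ (⊤ : ℕ∞) f) :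
    ContDiff ℝ (⊤ : ℕ∞) (sph f) := contDiff_angInt (contDiff_sphF hf)

theorem fderiv_sph_x {f : (Fin 4 → ℝ) → ℝ} (hf : ContDiff ℝ (⊤ : ℕ∞) f) (i : Fin 4)
    (p : (Fin 4 → ℝ) × ℝ) : fderiv ℝ (sph f) p (Pi.single i 1, 0) = sph (pd i f) p := by
  unfold sph
  rw [fderiv_angInt (contDiff_sphF hf)]
  simp only [fderiv_sphF_x hf]

theorem fderiv_sph_r {f : (Fin 4 → ℝ) → ℝ} (hf : ContDiff ℝ (⊤ : ℕ∞) f)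
    (p : (Fin 4 → ℝ) × ℝ) : fderiv ℝ (sph f) p (0, 1) = angInt (sphF1 f) p := by
  unfold sph
  rw [fderiv_angInt (contDiff_sphF hf)]
  simp only [fderiv_sphF_r hf]

theorem sphF_add (f g : (Fin 4 → ℝ) → ℝ) :
    sphF (fun y => f y + g y) = fun q => sphF f q + sphF g q := by
  funext q; simp only [sphF]; ring

theorem sph_add {f g : (Fin 4 → ℝ) → ℝ} (hf : ContDiff ℝ (⊤ : ℕ∞) f)
    (hg : ContDiff ℝ (⊤ : ℕ∞) g) (p : (Fin 4 → ℝ) × ℝ) :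
    sph (fun y => f y + g y) p = sph f p + sph g p := by
  unfold sph
  rw [sphF_add]
  exact angInt_add (contDiff_sphF hf) (contDiff_sphF hg) p

/-- Darboux equation. -/
theorem fderiv_sph_rr {f : (Fin 4 → ℝ) → ℝ} (hf : ContDiff ℝ (⊤ : ℕ∞) f)
    (p : (Fin 4 → ℝ) × ℝ) : fderiv ℝ (angInt (sphF1 f)) p (0, 1)
      = sph (pd 1 (pd 1 f)) p + (sph (pd 2 (pd 2 f)) p + sph (pd 3 (pd 3 f)) p) := by
  have h1 := contDiff_pd (contDiff_pd hf 1) 1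
  have h2 := contDiff_pd (contDiff_pd hf 2) 2
  have h3 := contDiff_pd (contDiff_pd hf 3) 3
  rw [fderiv_angInt (contDiff_sphF1 hf)]
  simp only [fderiv_sphF1_r hf]
  rw [← sph_add h2 h3, ← sph_add h1 (h2.add h3)]
  have hz := angular_zero hf p.1 p.2
  have hs := angInt_add (contDiff_sphF2 hf)
    ((contDiff_sphF (h1.add (h2.add h3))).sub (contDiff_sphF2 hf)) p
  have hz' : angInt (fun q =>
      sphF (fun y => pd 1 (pd 1 f) y + (pd 2 (pd 2 f) y + pd 3 (pd 3 f) y)) q - sphF2 f q) p = 0 :=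
    hz
  simp only [add_sub_cancel] at hs
  unfold sph
  have hs' : angInt (sphF fun y => pd 1 (pd 1 f) y + (pd 2 (pd 2 f) y + pd 3 (pd 3 f) y)) p
    = angInt (sphF2 f) p + angInt (fun q =>
      sphF (fun y => pd 1 (pd 1 f) y + (pd 2 (pd 2 f) y + pd 3 (pd 3 f) y)) q - sphF2 f q) p := hs
  rw [hs', hz', add_zero]

theorem sph_zero (f : (Fin 4 → ℝ) → ℝ) (x : Fin 4 → ℝ) : sph f (x, 0) = 0 := by
  simp [sph, angInt, sphF]

theorem sph1_zero (f : (Fin 4 → ℝ) → ℝ) (x : Fin 4 → ℝ) :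
    angInt (sphF1 f) (x, 0) = 4 * π * f x := by
  simp [angInt, sphF1, integral_sin]
  ring

end Darboux

section Duhamel

/-- The characteristic change of variables. -/
def chr (q : (Fin 4 → ℝ) × ℝ) : (Fin 4 → ℝ) × ℝ :=
  (q.1 + (q.2 - q.1 0) • (Pi.single 0 1 : Fin 4 → ℝ), q.1 0 - q.2)

theorem contDiff_chr : ContDiff ℝ (⊤ : ℕ∞) chr := by
  have : ContDiff ℝ (⊤ : ℕ∞) (fun q : (Fin 4 → ℝ) × ℝ => q.1 0) :=
    (contDiff_apply ℝ ℝ (0 : Fin 4)).comp contDiff_fst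
  unfold chr
  fun_prop

theorem chr_line (q w : (Fin 4 → ℝ) × ℝ) (t : ℝ) : chr (q + t • w) = chr q + t • chr w := by
  refine Prod.ext ?_ ?_
  · funext i
    simp [chr]
    ring
  · simp [chr]
    ring

/-- Duhamel integral. -/
def duh (V : (Fin 4 → ℝ) × ℝ → ℝ) (x : Fin 4 → ℝ) : ℝ :=
  ∫ s in (0 : ℝ)..(x 0), V (chr (x, s))

theorem contDiff_diag : ContDiff ℝ (⊤ : ℕ∞) (fun x : Fin 4 → ℝ => (x, x 0)) :=
  contDiff_id.prodMk (contDiff_apply ℝ ℝ (0 : Fin 4))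

theorem contDiff_duh {V : (Fin 4 → ℝ) × ℝ → ℝ} (hV : ContDiff ℝ (⊤ : ℕ∞) V) :
    ContDiff ℝ (⊤ : ℕ∞) (duh V) :=
  ContDiff.comp (g := fun p : (Fin 4 → ℝ) × ℝ => ∫ s in (0 : ℝ)..p.2, V (chr (p.1, s)))
    (contDiff_var (fun q => V (chr q)) (hV.comp contDiff_chr)) contDiff_diag

theorem duh_add {V U : (Fin 4 → ℝ) × ℝ → ℝ} (hV : ContDiff ℝ (⊤ : ℕ∞) V)
    (hU : ContDiff ℝ (⊤ : ℕ∞) U) (x : Fin 4 → ℝ) :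
    duh (fun q => V q + U q) x = duh V x + duh U x := by
  unfold duh
  have hc : Continuous fun s : ℝ => chr (x, s) :=
    contDiff_chr.continuous.comp (by fun_prop)
  exact intervalIntegral.integral_add ((hV.continuous.comp hc).intervalIntegrable _ _)
    ((hU.continuous.comp hc).intervalIntegrable _ _)

theorem pd_duh {V : (Fin 4 → ℝ) × ℝ → ℝ} (hV : ContDiff ℝ (⊤ : ℕ∞) V) (i : Fin 4)
    (x : Fin 4 → ℝ) :
    pd i (duh V) x = (Pi.single i (1 : ℝ) : Fin 4 → ℝ) 0 * V (x, 0)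
      + duh (fun q => fderiv ℝ V q (chr (Pi.single i 1, 0))) x := by
  have hK : ContDiff ℝ (⊤ : ℕ∞) (fun q => V (chr q)) := hV.comp contDiff_chr
  have h1 : HasFDerivAt (fun p : (Fin 4 → ℝ) × ℝ => ∫ s in (0 : ℝ)..p.2, V (chr (p.1, s))) _
      (x, x 0) :=
    ((contDiff_var (fun q => V (chr q)) hK).differentiable (by simp) (x, x 0)).hasFDerivAt
  have h2 : HasFDerivAt (fun x : Fin 4 → ℝ => (x, x 0))
      ((ContinuousLinearMap.id ℝ (Fin 4 → ℝ)).prod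
        (ContinuousLinearMap.proj (R := ℝ) (φ := fun _ : Fin 4 => ℝ) 0)) x :=
    (hasFDerivAt_id x).prodMk (hasFDerivAt_apply 0 x)
  have h3 := (HasFDerivAt.comp x h1 h2).fderiv
  have h4 : pd i (duh V) x = fderiv ℝ
      (fun p : (Fin 4 → ℝ) × ℝ => ∫ s in (0 : ℝ)..p.2, V (chr (p.1, s))) (x, x 0)
      (Pi.single i 1, (Pi.single i (1 : ℝ) : Fin 4 → ℝ) 0) :=
    congrArg (fun L => L (Pi.single i (1 : ℝ))) h3
  rw [h4, fderiv_var (fun q => V (chr q)) hK]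
  have h5 : ∀ q w, fderiv ℝ (fun q => V (chr q)) q w = fderiv ℝ V (chr q) (chr w) := by
    intro q w
    apply fderiv_line hK
    have e1 : HasFDerivAt V (fderiv ℝ V (chr q)) (chr q + (0 : ℝ) • chr w) := by
      simpa using (hV.differentiable (by simp) (chr q)).hasFDerivAt
    have e2 : HasDerivAt (fun t : ℝ => chr q + t • chr w) (chr w) 0 := by
      simpa using ((hasDerivAt_id (0 : ℝ)).smul_const (chr w)).const_add (chr q)
    exact hasDerivAt_of_eq (e1.comp_hasDerivAt 0 e2) (fun t => by simp [chr_line]) rfl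
  simp only [h5]
  have h6 : chr (x, x 0) = (x, 0) := by simp [chr]
  rw [h6]
  rfl

/-- Solvability of the wave equation. -/
theorem exists_wave {f : (Fin 4 → ℝ) → ℝ} (hf : ContDiff ℝ (⊤ : ℕ∞) f) :
    ∃ u : (Fin 4 → ℝ) → ℝ, ContDiff ℝ (⊤ : ℕ∞) u ∧
      ∀ x, - pd 0 (pd 0 u) x + pd 1 (pd 1 u) x + pd 2 (pd 2 u) x + pd 3 (pd 3 u) x = f x := by
  have hspace : ∀ {g : (Fin 4 → ℝ) → ℝ}, ContDiff ℝ (⊤ : ℕ∞) g → ∀ i : Fin 4, i ≠ 0 →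
      pd i (duh (sph g)) = duh (sph (pd i g)) := by
    intro g hg i hi
    funext x
    rw [pd_duh (contDiff_sph hg)]
    have h0 : (Pi.single i (1 : ℝ) : Fin 4 → ℝ) 0 = 0 := by simp [hi.symm]
    have hc : chr (Pi.single i 1, 0) = (Pi.single i 1, 0) := by simp [chr, h0]
    simp only [hc, h0, fderiv_sph_x hg]
    simp
  have hc0 : chr (Pi.single 0 1, 0) = (0, 1) := by simp [chr]
  have ht : pd 0 (duh (sph f)) = duh (angInt (sphF1 f)) := by
    funext x
    rw [pd_duh (contDiff_sph hf)]
    simp only [hc0, fderiv_sph_r hf, sph_zero]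
    simp
  have h1 := contDiff_pd (contDiff_pd hf 1) 1
  have h2 := contDiff_pd (contDiff_pd hf 2) 2
  have h3 := contDiff_pd (contDiff_pd hf 3) 3
  have htt : ∀ x, pd 0 (pd 0 (duh (sph f))) x = 4 * Real.pi * f x
      + (duh (sph (pd 1 (pd 1 f))) x + (duh (sph (pd 2 (pd 2 f))) x
        + duh (sph (pd 3 (pd 3 f))) x)) := by
    intro x
    rw [ht, pd_duh (contDiff_angInt (contDiff_sphF1 hf)), ← duh_add (contDiff_sph h2)
      (contDiff_sph h3), ← duh_add (contDiff_sph h1) ((contDiff_sph h2).add (contDiff_sph h3))]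
    simp only [hc0, fderiv_sph_rr hf, sph1_zero]
    simp
  have hs := contDiff_duh (contDiff_sph hf)
  have hcm : ∀ i, pd i (pd i (fun x => (- 1 / (4 * Real.pi)) * duh (sph f) x))
      = fun x => (- 1 / (4 * Real.pi)) * pd i (pd i (duh (sph f))) x := by
    intro i
    have e : pd i (fun x => (- 1 / (4 * Real.pi)) * duh (sph f) x)
      = fun x => (- 1 / (4 * Real.pi)) * pd i (duh (sph f)) x := funext fun x => pd_cmul hs _ i x
    rw [e]
    exact funext fun x => pd_cmul (contDiff_pd hs i) _ i x
  refine ⟨fun x => (- 1 / (4 * Real.pi)) * duh (sph f) x, contDiff_const.mul hs, fun x => ?_⟩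
  simp only [hcm, htt]
  rw [hspace hf 1 (by decide), hspace hf 2 (by decide), hspace hf 3 (by decide),
    hspace (contDiff_pd hf 1) 1 (by decide), hspace (contDiff_pd hf 2) 2 (by decide),
    hspace (contDiff_pd hf 3) 3 (by decide)]
  have := Real.pi_ne_zero
  field_simp
  ring

end Duhamel

section Assemble

/-- Diagonal entries of the metric. -/
def eta (a : Fin 4) : ℝ := if a = 0 then -1 else 1

theorem eta_sq (a : Fin 4) : eta a * eta a = 1 := by
  unfold eta; split_ifs <;> norm_num

theorem raise2_eq (X : Fin 4 → Fin 4 → ℝ) (a b : Fin 4) :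
    raise2 X a b = eta a * eta b * X a b := by
  unfold raise2 mink eta
  simp [ite_mul]

end Assemble

/-- Existence: for every smooth divergence-free vector field `Z` there is a smooth
closed field `X` of antisymmetric matrices with `∂_b X^{ab} = Z^a`. -/
theorem exists_closed_field_with_source
    (Z : (Fin 4 → ℝ) → Fin 4 → ℝ)
    (hsmooth : ∀ a, ContDiff ℝ (⊤ : ℕ∞) (fun x => Z x a))
    (hdiv : ∀ x : Fin 4 → ℝ, (∑ a, pd a (fun y => Z y a) x) = 0) :
    ∃ X : (Fin 4 → ℝ) → Fin 4 → Fin 4 → ℝ,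
      (∀ a b, ContDiff ℝ (⊤ : ℕ∞) (fun x => X x a b)) ∧
      (∀ x a b, X x a b = - X x b a) ∧
      (∀ (x : Fin 4 → ℝ) (a b c : Fin 4),
        pd a (fun y => X y b c) x + pd b (fun y => X y c a) x
          + pd c (fun y => X y a b) x = 0) ∧
      (∀ (x : Fin 4 → ℝ) (a : Fin 4), alphaCurrent X a x = Z x a) := by
  obtain ⟨W, hW, hWa, hWd⟩ := exists_potential (fun a y => Z y a) hsmooth hdiv
  choose u hu hbox using fun a b => exists_wave (hW a b)
  -- the antisymmetrized potential
  let U : Fin 4 → Fin 4 → (Fin 4 → ℝ) → ℝ := fun a b x => (1 / 2) * (u a b x - u b a x)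
  have hU : ∀ a b, ContDiff ℝ (⊤ : ℕ∞) (U a b) := fun a b =>
    contDiff_const.mul ((hu a b).sub (hu b a))
  have hUa : ∀ a b, U a b = fun x => (-1) * U b a x := fun a b => by
    funext x; simp only [U]; ring
  have hUp : ∀ a b c, pd c (U a b) = fun x => (1 / 2) * (pd c (u a b) x - pd c (u b a) x) := by
    intro a b c
    funext x
    rw [← pd_sub (hu a b) (hu b a), ← pd_cmul ((hu a b).sub (hu b a))]
  have hUpp : ∀ a b c x, pd c (pd c (U a b)) x
      = (1 / 2) * (pd c (pd c (u a b)) x - pd c (pd c (u b a)) x) := by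
    intro a b c x
    rw [hUp, ← pd_sub (contDiff_pd (hu a b) c) (contDiff_pd (hu b a) c),
      ← pd_cmul ((contDiff_pd (hu a b) c).sub (contDiff_pd (hu b a) c))]
  have hUbox : ∀ a b x, ∑ c, eta c * pd c (pd c (U a b)) x = W a b x := by
    intro a b x
    have h1 := hbox a b x
    have h2 := hbox b a x
    have h3 := hWa a b x
    simp only [hUpp, Fin.sum_univ_four]
    simp only [eta, Fin.reduceEq, if_true, if_false]
    linear_combination (1 / 2) * h1 - (1 / 2) * h2 - (1 / 2) * h3
  -- the vector potential, index up
  let B : Fin 4 → (Fin 4 → ℝ) → ℝ := fun a x => ∑ b, pd b (U a b) x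
  have hB : ∀ a, ContDiff ℝ (⊤ : ℕ∞) (B a) := fun a =>
    ContDiff.sum fun b _ => contDiff_pd (hU a b) b
  have hBd : ∀ a c, pd c (B a) = fun x => ∑ b, pd c (pd b (U a b)) x := by
    intro a c
    funext x
    exact pd_sum (fun b => contDiff_pd (hU a b) b) c x
  have hdivB : (fun x => ∑ a, pd a (B a) x) = fun _ => 0 := by
    funext x
    have hsw : ∀ a b, pd a (pd b (U a b)) x = - pd b (pd a (U b a)) x := by
      intro a b
      have e : pd b (U a b) = fun x => (-1) * pd b (U b a) x := by
        rw [hUa a b]; funext y; exact pd_cmul (hU b a) _ b y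
      rw [e, pd_cmul (contDiff_pd (hU b a) b), pd_comm (hU b a)]
      ring
    simp only [hBd]
    have h1 : ∑ a, ∑ b, pd a (pd b (U a b)) x = - ∑ a, ∑ b, pd a (pd b (U a b)) x := by
      conv_lhs => rw [Finset.sum_comm]
      rw [← Finset.sum_neg_distrib]
      refine Finset.sum_congr rfl fun a _ => ?_
      rw [← Finset.sum_neg_distrib]
      exact Finset.sum_congr rfl fun b _ => hsw b a
    linarith
  have hBbox : ∀ a x, ∑ c, eta c * pd c (pd c (B a)) x = Z x a := by
    intro a x
    rw [← hWd a x]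
    have hWU : ∀ b, W a b = fun x => ∑ c, eta c * pd c (pd c (U a b)) x := fun b =>
      funext fun y => (hUbox a b y).symm
    have hpp := fun b c => contDiff_pd (contDiff_pd (hU a b) c) c
    have h1 : ∀ b, pd b (W a b) x = ∑ c, eta c * pd b (pd c (pd c (U a b))) x := by
      intro b
      rw [hWU, pd_sum (fun c => contDiff_const.mul (hpp b c))]
      exact Finset.sum_congr rfl fun c _ => pd_cmul (hpp b c) _ b x
    have h2 : ∀ c, pd c (pd c (B a)) x = ∑ b, pd c (pd c (pd b (U a b))) x := by
      intro c
      rw [hBd, pd_sum (fun b => contDiff_pd (contDiff_pd (hU a b) b) c)]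
    simp only [h1, h2, Finset.mul_sum]
    rw [Finset.sum_comm]
    refine Finset.sum_congr rfl fun b _ => Finset.sum_congr rfl fun c _ => ?_
    have e : pd c (pd b (U a b)) = pd b (pd c (U a b)) := funext fun y => pd_comm (hU a b) c b y
    rw [e, pd_comm (contDiff_pd (hU a b) c)]
  -- the field
  have hp := fun a b => contDiff_pd (hB a) b
  have hX : ∀ a b, ContDiff ℝ (⊤ : ℕ∞)
      (fun x => eta a * pd b (B a) x - eta b * pd a (B b) x) := fun a b =>
    (contDiff_const.mul (hp a b)).sub (contDiff_const.mul (hp b a))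
  have hXd : ∀ a b c x, pd c (fun x => eta a * pd b (B a) x - eta b * pd a (B b) x) x
      = eta a * pd c (pd b (B a)) x - eta b * pd c (pd a (B b)) x := by
    intro a b c x
    rw [pd_sub (contDiff_const.mul (hp a b)) (contDiff_const.mul (hp b a)),
      pd_cmul (hp a b), pd_cmul (hp b a)]
  refine ⟨fun x a b => eta a * pd b (B a) x - eta b * pd a (B b) x, hX, ?_, ?_, ?_⟩
  · intro x a b; ring
  · intro x a b c
    simp only [hXd]
    rw [pd_comm (hB b) a c, pd_comm (hB c) a b, pd_comm (hB a) b c]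
    ring
  · intro x a
    unfold alphaCurrent
    simp only [raise2_eq]
    have h1 : ∀ b, pd b (fun y => eta a * eta b * (eta a * pd b (B a) y - eta b * pd a (B b) y)) x
        = eta b * pd b (pd b (B a)) x - eta a * pd a (pd b (B b)) x := by
      intro b
      rw [pd_cmul (hX a b), hXd, pd_comm (hB b) b a]
      linear_combination (eta b * pd b (pd b (B a)) x) * eta_sq a
        - (eta a * pd a (pd b (B b)) x) * eta_sq b
    simp only [h1]
    rw [Finset.sum_sub_distrib, hBbox, ← Finset.mul_sum, ← pd_sum (fun b => hp b b), hdivB]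
    simp [pd]
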